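/- Let T > 0, let g > 0, h₀ > 0, ω₀ ∈ ℝ, c₀ ∈ ℝ, and set κ = ω₀·√(g h₀)/g + c₀. Let η : ℝ×ℝ → ℝ (η = η(x,t)) be smooth and suppose that for every test function ψ on ℝ×(0,T), ∫₀^T ∫_ℝ { (η + κ)·(ψ_t + η ψ_x − ψ η_x) + η_x·(ψ_tx + η ψ_xx − ψ η_xx) } dx dt = 0. Then η satisfies the Camassa–Holm equation with parameter κ, i.e. η_t + 2κ η_x + 3η η_x − η_txx = 2 η_x η_xx + η η_xxx at every point of ℝ×(0,T). (This is the precise weak form of the paper's Theorem 3: for a rotational unidirectional shallow water flow with constant vorticity ω₀, the displacement of the free surface from the flat state satisfies the Camassa–Holm equation with κ = ω₀√(g h₀)/g + c₀.) -/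

import Mathlib

open MeasureTheory Set

/-- Partial derivative in the first (spatial) variable `x` of `u = u(x,t)`. -/
noncomputable def pdx (u : ℝ × ℝ → ℝ) : ℝ × ℝ → ℝ :=
  fun p => deriv (fun x => u (x, p.2)) p.1

/-- Partial derivative in the second (time) variable `t` of `u = u(x,t)`. -/
noncomputable def pdt (u : ℝ × ℝ → ℝ) : ℝ × ℝ → ℝ :=
  fun p => deriv (fun t => u (p.1, t)) p.2

/-- A test function on `ℝ × (0,T)`: smooth, compactly supported, with support
contained in `ℝ × (0,T)`. -/
def IsTestFun (T : ℝ) (ψ : ℝ × ℝ → ℝ) : Prop :=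
  ContDiff ℝ (⊤ : ℕ∞) ψ ∧ HasCompactSupport ψ ∧ tsupport ψ ⊆ univ ×ˢ Ioo 0 T


theorem pdx_eq_fderiv {u : ℝ × ℝ → ℝ} (hu : Differentiable ℝ u) :
    pdx u = fun p => fderiv ℝ u p (1, 0) := by
  funext p
  have h : HasDerivAt (fun x : ℝ => (x, p.2)) ((1 : ℝ), (0 : ℝ)) p.1 :=
    (hasDerivAt_id p.1).prodMk (hasDerivAt_const p.1 p.2)
  exact ((hu p).hasFDerivAt.comp_hasDerivAt p.1 h).deriv

theorem pdt_eq_fderiv {u : ℝ × ℝ → ℝ} (hu : Differentiable ℝ u) :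
    pdt u = fun p => fderiv ℝ u p (0, 1) := by
  funext p
  have h : HasDerivAt (fun t : ℝ => (p.1, t)) ((0 : ℝ), (1 : ℝ)) p.2 :=
    (hasDerivAt_const p.2 p.1).prodMk (hasDerivAt_id p.2)
  exact ((hu p).hasFDerivAt.comp_hasDerivAt p.2 h).deriv

theorem ContDiff.differentiable_of_top {u : ℝ × ℝ → ℝ} (hu : ContDiff ℝ (⊤ : ℕ∞) u) :
    Differentiable ℝ u :=
  hu.differentiable (by simp)

theorem ContDiff.fderiv_apply_const {u : ℝ × ℝ → ℝ} (hu : ContDiff ℝ (⊤ : ℕ∞) u) (v : ℝ × ℝ) :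
    ContDiff ℝ (⊤ : ℕ∞) fun p => fderiv ℝ u p v :=
  (hu.fderiv_right (m := (⊤ : ℕ∞)) (by simp)).clm_apply contDiff_const

theorem ContDiff.pdx {u : ℝ × ℝ → ℝ} (hu : ContDiff ℝ (⊤ : ℕ∞) u) :
    ContDiff ℝ (⊤ : ℕ∞) (pdx u) := by
  rw [pdx_eq_fderiv hu.differentiable_of_top]
  exact hu.fderiv_apply_const _

theorem ContDiff.pdt {u : ℝ × ℝ → ℝ} (hu : ContDiff ℝ (⊤ : ℕ∞) u) :
    ContDiff ℝ (⊤ : ℕ∞) (pdt u) := by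
  rw [pdt_eq_fderiv hu.differentiable_of_top]
  exact hu.fderiv_apply_const _

theorem pdx_mul {u v : ℝ × ℝ → ℝ} (hu : ContDiff ℝ (⊤ : ℕ∞) u) (hv : ContDiff ℝ (⊤ : ℕ∞) v) :
    pdx (fun p => u p * v p) = fun p => pdx u p * v p + u p * pdx v p := by
  have hu' := hu.differentiable_of_top
  have hv' := hv.differentiable_of_top
  rw [pdx_eq_fderiv (u := fun p => u p * v p) (hu'.mul hv'), pdx_eq_fderiv hu', pdx_eq_fderiv hv']
  funext p
  rw [fderiv_fun_mul (hu' p) (hv' p)]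
  simp
  ring

theorem pdx_add {u v : ℝ × ℝ → ℝ} (hu : ContDiff ℝ (⊤ : ℕ∞) u) (hv : ContDiff ℝ (⊤ : ℕ∞) v) :
    pdx (fun p => u p + v p) = fun p => pdx u p + pdx v p := by
  have hu' := hu.differentiable_of_top
  have hv' := hv.differentiable_of_top
  rw [pdx_eq_fderiv (u := fun p => u p + v p) (hu'.add hv'), pdx_eq_fderiv hu', pdx_eq_fderiv hv']
  funext p
  rw [fderiv_fun_add (hu' p) (hv' p)]
  simp

theorem pdx_add_const (u : ℝ × ℝ → ℝ) (c : ℝ) : pdx (fun p => u p + c) = pdx u := by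
  funext p
  simp [pdx]

theorem pdt_add_const (u : ℝ × ℝ → ℝ) (c : ℝ) : pdt (fun p => u p + c) = pdt u := by
  funext p
  simp [pdt]

theorem fderiv_fderiv_apply_comm {u : ℝ × ℝ → ℝ} (hu : ContDiff ℝ (⊤ : ℕ∞) u) (p v w : ℝ × ℝ) :
    fderiv ℝ (fun q => fderiv ℝ u q v) p w = fderiv ℝ (fun q => fderiv ℝ u q w) p v := by
  have hd : DifferentiableAt ℝ (fderiv ℝ u) p :=
    (hu.fderiv_right (m := (⊤ : ℕ∞)) (by simp)).differentiable (by simp) p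
  have hsymm : IsSymmSndFDerivAt ℝ u p :=
    (contDiff_infty.1 hu 2).contDiffAt.isSymmSndFDerivAt (by simp)
  rw [fderiv_clm_apply hd (differentiableAt_const v),
    fderiv_clm_apply hd (differentiableAt_const w)]
  simpa using hsymm w v

theorem pdt_pdx_comm {u : ℝ × ℝ → ℝ} (hu : ContDiff ℝ (⊤ : ℕ∞) u) :
    pdt (pdx u) = pdx (pdt u) := by
  rw [pdt_eq_fderiv hu.pdx.differentiable_of_top, pdx_eq_fderiv hu.pdt.differentiable_of_top,
    pdx_eq_fderiv hu.differentiable_of_top, pdt_eq_fderiv hu.differentiable_of_top]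
  funext p
  exact fderiv_fderiv_apply_comm hu p _ _

theorem integral_mul_fderiv_apply_eq_neg {f g : ℝ × ℝ → ℝ} (hf : ContDiff ℝ (⊤ : ℕ∞) f)
    (hg : ContDiff ℝ (⊤ : ℕ∞) g) (hc : HasCompactSupport g) (v : ℝ × ℝ) :
    ∫ p, f p * fderiv ℝ g p v = -∫ p, fderiv ℝ f p v * g p := by
  apply integral_mul_fderiv_eq_neg_fderiv_mul_of_integrable
  · exact ((hf.fderiv_apply_const v).continuous.mul hg.continuous).integrable_of_hasCompactSupport
      hc.mul_left
  · exact (hf.continuous.mul (hg.fderiv_apply_const v).continuous).integrable_of_hasCompactSupport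
      (hc.fderiv_apply ℝ v).mul_left
  · exact (hf.continuous.mul hg.continuous).integrable_of_hasCompactSupport hc.mul_left
  · exact fun p _ => hf.differentiable_of_top p
  · exact fun p _ => hg.differentiable_of_top p

theorem integral_mul_pdx {f g : ℝ × ℝ → ℝ} (hf : ContDiff ℝ (⊤ : ℕ∞) f)
    (hg : ContDiff ℝ (⊤ : ℕ∞) g) (hc : HasCompactSupport g) :
    ∫ p, f p * pdx g p = -∫ p, pdx f p * g p := by
  rw [pdx_eq_fderiv hf.differentiable_of_top, pdx_eq_fderiv hg.differentiable_of_top]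
  exact integral_mul_fderiv_apply_eq_neg hf hg hc _

theorem integral_mul_pdt {f g : ℝ × ℝ → ℝ} (hf : ContDiff ℝ (⊤ : ℕ∞) f)
    (hg : ContDiff ℝ (⊤ : ℕ∞) g) (hc : HasCompactSupport g) :
    ∫ p, f p * pdt g p = -∫ p, pdt f p * g p := by
  rw [pdt_eq_fderiv hf.differentiable_of_top, pdt_eq_fderiv hg.differentiable_of_top]
  exact integral_mul_fderiv_apply_eq_neg hf hg hc _

theorem IsTestFun.pdx {T : ℝ} {ψ : ℝ × ℝ → ℝ} (h : IsTestFun T ψ) : IsTestFun T (pdx ψ) := by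
  refine ⟨h.1.pdx, ?_⟩
  rw [pdx_eq_fderiv h.1.differentiable_of_top]
  exact ⟨h.2.1.fderiv_apply ℝ _, (tsupport_fderiv_apply_subset ℝ _).trans h.2.2⟩

theorem IsTestFun.pdt {T : ℝ} {ψ : ℝ × ℝ → ℝ} (h : IsTestFun T ψ) : IsTestFun T (pdt ψ) := by
  refine ⟨h.1.pdt, ?_⟩
  rw [pdt_eq_fderiv h.1.differentiable_of_top]
  exact ⟨h.2.1.fderiv_apply ℝ _, (tsupport_fderiv_apply_subset ℝ _).trans h.2.2⟩

theorem IsTestFun.eq_zero {T : ℝ} {ψ : ℝ × ℝ → ℝ} (h : IsTestFun T ψ) {x t : ℝ}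
    (ht : t ∉ Ioo 0 T) : ψ (x, t) = 0 :=
  image_eq_zero_of_notMem_tsupport fun hm => ht (h.2.2 hm).2

theorem IsTestFun.integrable_mul {T : ℝ} {ψ : ℝ × ℝ → ℝ} (h : IsTestFun T ψ) {f : ℝ × ℝ → ℝ}
    (hf : ContDiff ℝ (⊤ : ℕ∞) f) : Integrable fun p => f p * ψ p :=
  (hf.continuous.mul h.1.continuous).integrable_of_hasCompactSupport h.2.1.mul_left

/-- The iterated integral over the strip of a function vanishing off the strip is the integral
over the plane. -/
theorem setIntegral_Ioo_integral_eq {T : ℝ} {F : ℝ × ℝ → ℝ} (hF : Integrable F)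
    (h0 : ∀ x, ∀ t ∉ Ioo 0 T, F (x, t) = 0) :
    ∫ t in Ioo (0 : ℝ) T, ∫ x : ℝ, F (x, t) = ∫ p, F p := by
  rw [setIntegral_eq_integral_of_forall_compl_eq_zero fun t ht => by simp [h0 _ t ht]]
  exact (integral_prod_symm F hF).symm

/-- Coefficients paired with a test function and its derivatives: integration by parts moves
all derivatives onto the coefficients. -/
theorem integral_isTestFun_eq {T : ℝ} {ψ : ℝ × ℝ → ℝ} (h : IsTestFun T ψ)
    {a b c d e : ℝ × ℝ → ℝ} (ha : ContDiff ℝ (⊤ : ℕ∞) a) (hb : ContDiff ℝ (⊤ : ℕ∞) b)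
    (hc : ContDiff ℝ (⊤ : ℕ∞) c) (hd : ContDiff ℝ (⊤ : ℕ∞) d) (he : ContDiff ℝ (⊤ : ℕ∞) e) :
    ∫ t in Ioo (0 : ℝ) T, ∫ x : ℝ, (a (x, t) * pdt ψ (x, t) + b (x, t) * pdx ψ (x, t)
        + c (x, t) * ψ (x, t) + d (x, t) * pdx (pdt ψ) (x, t) + e (x, t) * pdx (pdx ψ) (x, t))
      = ∫ p, ψ p * (-pdt a p - pdx b p + c p + pdt (pdx d) p + pdx (pdx e) p) := by
  have ia := h.pdt.integrable_mul ha
  have ib := h.pdx.integrable_mul hb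
  have ic := h.integrable_mul hc
  have idt := h.pdt.pdx.integrable_mul hd
  have ie := h.pdx.pdx.integrable_mul he
  rw [setIntegral_Ioo_integral_eq (F := fun p => a p * pdt ψ p + b p * pdx ψ p
    + c p * ψ p + d p * pdx (pdt ψ) p + e p * pdx (pdx ψ) p)
    ((((ia.fun_add ib).fun_add ic).fun_add idt).fun_add ie) fun x t ht => by
      simp [h.eq_zero ht, h.pdt.eq_zero ht, h.pdx.eq_zero ht, h.pdt.pdx.eq_zero ht,
        h.pdx.pdx.eq_zero ht]]
  rw [integral_add (((ia.fun_add ib).fun_add ic).fun_add idt) ie, integral_add ((ia.fun_add ib).fun_add ic) idt,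
    integral_add (ia.fun_add ib) ic, integral_add ia ib,
    integral_mul_pdt ha h.1 h.2.1, integral_mul_pdx hb h.1 h.2.1,
    integral_mul_pdx hd h.pdt.1 h.pdt.2.1, integral_mul_pdt hd.pdx h.1 h.2.1,
    integral_mul_pdx he h.pdx.1 h.pdx.2.1, integral_mul_pdx he.pdx h.1 h.2.1, neg_neg, neg_neg]
  have ja : Integrable fun p => -(pdt a p * ψ p) := (h.integrable_mul ha.pdt).neg
  have jb : Integrable fun p => -(pdx b p * ψ p) := (h.integrable_mul hb.pdx).neg
  have jd := h.integrable_mul hd.pdx.pdt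
  have je := h.integrable_mul he.pdx.pdx
  rw [← integral_neg, ← integral_neg, ← integral_add ja jb,
    ← integral_add (ja.fun_add jb) ic, ← integral_add ((ja.fun_add jb).fun_add ic) jd,
    ← integral_add (((ja.fun_add jb).fun_add ic).fun_add jd) je]
  congr 1
  funext p
  ring

/-- A continuous function annihilating all test functions on the strip vanishes there. -/
theorem eq_zero_of_forall_isTestFun {T : ℝ} {E : ℝ × ℝ → ℝ} (hE : Continuous E)
    (h : ∀ ψ, IsTestFun T ψ → ∫ p, ψ p * E p = 0) (x : ℝ) {t : ℝ} (ht : t ∈ Ioo 0 T) :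
    E (x, t) = 0 := by
  have hU : IsOpen ((univ : Set ℝ) ×ˢ Ioo (0 : ℝ) T) := isOpen_univ.prod isOpen_Ioo
  have hae := hU.ae_eq_zero_of_integral_contDiff_smul_eq_zero (μ := volume)
    (hE.locallyIntegrable.locallyIntegrableOn _) fun ψ h1 h2 h3 => h ψ ⟨h1, h2, h3⟩
  exact Measure.eqOn_open_of_ae_eq (g := fun _ => (0 : ℝ))
    ((ae_restrict_iff' hU.measurableSet).2 hae) hU hE.continuousOn continuousOn_const
    ⟨mem_univ x, ht⟩

/-- Theorem 3 (weak form): for a rotational unidirectional shallow water flow with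
constant vorticity `ω₀`, if the free-surface displacement `η` annihilates the
first-variation functional against every test function on `ℝ × (0,T)`, then `η`
satisfies the Camassa–Holm equation with `κ = ω₀ √(g h₀) / g + c₀`. -/
theorem camassaHolm_surface_of_weak_constantVorticity
    (T : ℝ) (hT : 0 < T) (g h₀ ω₀ c₀ : ℝ) (hg : 0 < g) (hh₀ : 0 < h₀)
    (κ : ℝ) (hκ : κ = ω₀ * Real.sqrt (g * h₀) / g + c₀)
    (η : ℝ × ℝ → ℝ) (hη : ContDiff ℝ (⊤ : ℕ∞) η)
    (hweak : ∀ ψ : ℝ × ℝ → ℝ, IsTestFun T ψ →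
      (∫ t in Ioo (0:ℝ) T, ∫ x : ℝ,
          ((η (x, t) + κ) * (pdt ψ (x, t) + η (x, t) * pdx ψ (x, t) - ψ (x, t) * pdx η (x, t))
            + pdx η (x, t) * (pdx (pdt ψ) (x, t) + η (x, t) * pdx (pdx ψ) (x, t)
                - ψ (x, t) * pdx (pdx η) (x, t)))) = 0) :
    ∀ x : ℝ, ∀ t ∈ Ioo (0:ℝ) T,
      pdt η (x, t) + 2 * κ * pdx η (x, t) + 3 * η (x, t) * pdx η (x, t)
          - pdx (pdx (pdt η)) (x, t)
        = 2 * pdx η (x, t) * pdx (pdx η) (x, t)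
            + η (x, t) * pdx (pdx (pdx η)) (x, t) := by
  intro x t ht
  have hx := hη.pdx
  have hxx := hx.pdx
  have hA : ContDiff ℝ (⊤ : ℕ∞) fun p => η p + κ := hη.add contDiff_const
  have hAη := hA.mul hη
  have hC : ContDiff ℝ (⊤ : ℕ∞) fun p =>
      -((η p + κ) * pdx η p) - pdx η p * pdx (pdx η) p := (hA.mul hx).neg.sub (hx.mul hxx)
  have hxη := hx.mul hη
  have key := eq_zero_of_forall_isTestFun (T := T)
    (((((hA.pdt.neg.sub hAη.pdx).add hC).add hx.pdx.pdt).add hxη.pdx.pdx).continuous)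
    (fun ψ hψ => by
      rw [← hweak ψ hψ]
      refine (integral_isTestFun_eq hψ hA hAη hC hx hxη).symm.trans ?_
      congr 1
      funext t
      congr 1
      funext x
      ring) x ht
  rw [pdx_mul hA hη, pdx_mul hx hη, pdx_add (hxx.mul hη) (hx.mul hx), pdx_mul hxx hη,
    pdx_mul hx hx, pdx_add_const, pdt_add_const, pdt_pdx_comm hx, pdt_pdx_comm hη] at key
  linarith
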